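/- Let (X₁ᵢ, X₂ᵢ, Wᵢ), i=1,…,n, be i.i.d. with pmf q_{X₁X₂W} on finite sets, let K₁ be uniform on [1:2^{nR₀₁}] and independent of (X₁ⁿ,X₂ⁿ,Wⁿ), and let Ỹ₁ⁿ and Yⁿ be finite-valued random vectors jointly distributed with (K₁,X₁ⁿ,X₂ⁿ,Wⁿ). Let q_{X₁X₂WY} be a pmf whose (X₁,X₂,W)-marginal is q_{X₁X₂W}, and suppose the joint distribution of (X₁ⁿ,X₂ⁿ,Wⁿ,Yⁿ) satisfies ‖p_{X₁ⁿX₂ⁿWⁿYⁿ} − q^{(n)}_{X₁X₂WY}‖₁ ≤ ε for some ε ∈ (0,1]. Then n·R₀₁ ≥ Σ_{i=1}^n I(K₁, Ỹ₁_{∼i}, W_{∼i}, Ỹ₁ᵢ ; X₁ᵢ, Yᵢ | X₂ᵢ, Wᵢ) − Σ_{i=1}^n H(Ỹ₁ᵢ|Wᵢ) − n·g(ε), where g(ε) = 2√ε·(H_q(X₁,X₂,W,Y) + log(|𝒳₁||𝒳₂||𝒲||𝒴|) + log(1/√ε)). -/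

import Mathlib

open scoped BigOperators

noncomputable section

/-- `p` is a probability mass function on the finite type `α`. -/
def IsPMF {α : Type*} [Fintype α] (p : α → ℝ) : Prop :=
  (∀ a, 0 ≤ p a) ∧ ∑ a, p a = 1

/-- Distribution (pushforward pmf) of the random variable `X` under the pmf `μ`. -/
def rvDist {Ω α : Type*} [Fintype Ω] [DecidableEq α] (μ : Ω → ℝ) (X : Ω → α) : α → ℝ :=
  fun a => ∑ ω, if X ω = a then μ ω else 0

/-- Shannon entropy (natural logarithm) of a pmf on a finite type. -/
def ent {α : Type*} [Fintype α] (p : α → ℝ) : ℝ := ∑ a, Real.negMulLog (p a)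

/-- Entropy of a random variable `X` under the pmf `μ`. -/
def H {Ω α : Type*} [Fintype Ω] [Fintype α] [DecidableEq α] (μ : Ω → ℝ) (X : Ω → α) : ℝ :=
  ent (rvDist μ X)

/-- Conditional entropy `H(X | Z)`. -/
def condH {Ω α γ : Type*} [Fintype Ω] [Fintype α] [Fintype γ] [DecidableEq α] [DecidableEq γ]
    (μ : Ω → ℝ) (X : Ω → α) (Z : Ω → γ) : ℝ :=
  H μ (fun ω => (X ω, Z ω)) - H μ Z

/-- Mutual information `I(X; Y)`. -/
def mutI {Ω α β : Type*} [Fintype Ω] [Fintype α] [Fintype β] [DecidableEq α] [DecidableEq β]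
    (μ : Ω → ℝ) (X : Ω → α) (Y : Ω → β) : ℝ :=
  H μ X + H μ Y - H μ (fun ω => (X ω, Y ω))

/-- Conditional mutual information `I(X; Y | Z)`. -/
def condI {Ω α β γ : Type*} [Fintype Ω] [Fintype α] [Fintype β] [Fintype γ]
    [DecidableEq α] [DecidableEq β] [DecidableEq γ]
    (μ : Ω → ℝ) (X : Ω → α) (Y : Ω → β) (Z : Ω → γ) : ℝ :=
  H μ (fun ω => (X ω, Z ω)) + H μ (fun ω => (Y ω, Z ω))
    - H μ (fun ω => (X ω, Y ω, Z ω)) - H μ Z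

set_option synthInstance.maxSize 512

section helpers

variable {Ω : Type*} [Fintype Ω] {μ : Ω → ℝ}

lemma sum_rvDist_mul {α : Type*} [Fintype α] [DecidableEq α] (μ : Ω → ℝ) (X : Ω → α) (F : α → ℝ) :
    ∑ a, rvDist μ X a * F a = ∑ ω, μ ω * F (X ω) := by
  unfold rvDist
  simp_rw [Finset.sum_mul]
  rw [Finset.sum_comm]
  refine Finset.sum_congr rfl fun ω _ => ?_
  simp [ite_mul]

lemma rvDist_nonneg {α : Type*} [DecidableEq α] (h : IsPMF μ) (X : Ω → α) (a : α) :
    0 ≤ rvDist μ X a :=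
  Finset.sum_nonneg fun ω _ => by split_ifs <;> simp [h.1 ω]

lemma rvDist_isPMF {α : Type*} [Fintype α] [DecidableEq α] (h : IsPMF μ) (X : Ω → α) :
    IsPMF (rvDist μ X) := by
  refine ⟨rvDist_nonneg h X, ?_⟩
  have := sum_rvDist_mul μ X (fun _ => 1)
  simpa [h.2] using this

lemma le_rvDist {α : Type*} [DecidableEq α] (h : IsPMF μ) (X : Ω → α) (ω : Ω) :
    μ ω ≤ rvDist μ X (X ω) := by
  have := Finset.single_le_sum (f := fun ω' => if X ω' = X ω then μ ω' else 0)
    (fun ω' _ => by split_ifs <;> simp [h.1 ω']) (Finset.mem_univ ω)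
  simpa [rvDist] using this

lemma rvDist_le_one {α : Type*} [DecidableEq α] (h : IsPMF μ) (X : Ω → α) (a : α) :
    rvDist μ X a ≤ 1 := by
  rw [← h.2]
  exact Finset.sum_le_sum fun ω _ => by split_ifs <;> simp [h.1 ω]

lemma H_eq_sum {α : Type*} [Fintype α] [DecidableEq α] (μ : Ω → ℝ) (X : Ω → α) :
    H μ X = - ∑ ω, μ ω * Real.log (rvDist μ X (X ω)) := by
  rw [← sum_rvDist_mul μ X (fun a => Real.log (rvDist μ X a))]
  simp [H, ent, Real.negMulLog]

lemma H_congr {α β : Type*} [Fintype α] [DecidableEq α] [Fintype β] [DecidableEq β]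
    (X : Ω → α) (Y : Ω → β) (h : ∀ ω ω', X ω = X ω' ↔ Y ω = Y ω') : H μ X = H μ Y := by
  rw [H_eq_sum, H_eq_sum]
  simp only [rvDist, h]

lemma H_mono {α β : Type*} [Fintype α] [DecidableEq α] [Fintype β] [DecidableEq β]
    (hμ : IsPMF μ) (X : Ω → α) (Y : Ω → β) (h : ∀ ω ω', X ω = X ω' → Y ω = Y ω') :
    H μ Y ≤ H μ X := by
  rw [H_eq_sum, H_eq_sum]
  refine neg_le_neg (Finset.sum_le_sum fun ω _ => ?_)
  rcases (hμ.1 ω).eq_or_lt with h0 | h0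
  · simp [← h0]
  · refine mul_le_mul_of_nonneg_left (Real.log_le_log (h0.trans_le (le_rvDist hμ X ω)) ?_) h0.le
    refine Finset.sum_le_sum fun ω' _ => ?_
    by_cases hx : X ω' = X ω
    · simp [hx, h _ _ hx]
    · simp only [hx, if_false]
      split_ifs <;> simp [hμ.1 ω']

lemma H_nonneg {α : Type*} [Fintype α] [DecidableEq α] (hμ : IsPMF μ) (X : Ω → α) : 0 ≤ H μ X :=
  Finset.sum_nonneg fun a _ =>
    Real.negMulLog_nonneg (rvDist_nonneg hμ X a) (rvDist_le_one hμ X a)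

lemma rvDist_fst {α β : Type*} [Fintype β] [DecidableEq α] [DecidableEq β]
    (X : Ω → α) (Y : Ω → β) (a : α) :
    ∑ b, rvDist μ (fun ω => (X ω, Y ω)) (a, b) = rvDist μ X a := by
  unfold rvDist
  rw [Finset.sum_comm]
  refine Finset.sum_congr rfl fun ω _ => ?_
  by_cases h : X ω = a <;> simp [h]

lemma rvDist_snd {α β : Type*} [Fintype α] [DecidableEq α] [DecidableEq β]
    (X : Ω → α) (Y : Ω → β) (b : β) :
    ∑ a, rvDist μ (fun ω => (X ω, Y ω)) (a, b) = rvDist μ Y b := by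
  unfold rvDist
  rw [Finset.sum_comm]
  refine Finset.sum_congr rfl fun ω _ => ?_
  by_cases h : Y ω = b <;> simp [h]

/-- Submodularity of entropy. -/
lemma H_submod {α β γ : Type*} [Fintype α] [DecidableEq α] [Fintype β] [DecidableEq β]
    [Fintype γ] [DecidableEq γ] (hμ : IsPMF μ) (X : Ω → α) (Y : Ω → β) (Z : Ω → γ) :
    H μ (fun ω => (X ω, Y ω, Z ω)) + H μ Z ≤
      H μ (fun ω => (X ω, Z ω)) + H μ (fun ω => (Y ω, Z ω)) := by
  set pxyz := rvDist μ (fun ω => (X ω, Y ω, Z ω)) with hxyz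
  set pxz := rvDist μ (fun ω => (X ω, Z ω)) with hxz
  set pyz := rvDist μ (fun ω => (Y ω, Z ω)) with hyz
  set pz := rvDist μ Z with hz
  have n1 : ∀ a, 0 ≤ pxyz a := rvDist_nonneg hμ _
  have n2 : ∀ a, 0 ≤ pxz a := rvDist_nonneg hμ _
  have n3 : ∀ a, 0 ≤ pyz a := rvDist_nonneg hμ _
  have n4 : ∀ a, 0 ≤ pz a := rvDist_nonneg hμ _
  let F : α × β × γ → ℝ := fun t =>
    pxz (t.1, t.2.2) * pyz (t.2.1, t.2.2) / (pxyz t * pz t.2.2)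
  have hF : ∑ ω, μ ω * F (X ω, Y ω, Z ω) ≤ 1 := by
    rw [← sum_rvDist_mul μ (fun ω => (X ω, Y ω, Z ω)) F]
    calc ∑ t, pxyz t * F t
        ≤ ∑ t : α × β × γ, pxz (t.1, t.2.2) * pyz (t.2.1, t.2.2) / pz t.2.2 := by
          refine Finset.sum_le_sum fun t _ => ?_
          rcases (n1 t).eq_or_lt with h0 | h0
          · rw [← h0, zero_mul]
            exact div_nonneg (mul_nonneg (n2 _) (n3 _)) (n4 _)
          · apply le_of_eq
            simp only [F]
            rw [mul_div_assoc', mul_div_mul_left _ _ h0.ne']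
      _ = ∑ z, (∑ x, pxz (x, z)) * (∑ y, pyz (y, z)) / pz z := by
          simp_rw [Finset.sum_mul_sum, Finset.sum_div]
          rw [Fintype.sum_prod_type]
          simp_rw [Fintype.sum_prod_type]
          rw [Finset.sum_comm' (t' := Finset.univ) (s' := fun _ => Finset.univ) (by simp)]
          rw [Finset.sum_comm]
          rw [Finset.sum_comm]
          conv_rhs => rw [Finset.sum_comm]
          conv_rhs => enter [2, x]; rw [Finset.sum_comm]
          rw [Finset.sum_comm]
      _ = ∑ z, pz z * pz z / pz z := by
          refine Finset.sum_congr rfl fun z _ => ?_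
          rw [hxz, hyz, rvDist_snd, rvDist_snd]
      _ = ∑ z, pz z := by
          refine Finset.sum_congr rfl fun z _ => ?_
          rw [mul_self_div_self]
      _ = 1 := (rvDist_isPMF hμ Z).2
      _ ≤ 1 := le_rfl
  have key : ∑ ω, μ ω * (Real.log (pxz (X ω, Z ω)) + Real.log (pyz (Y ω, Z ω))
      - Real.log (pxyz (X ω, Y ω, Z ω)) - Real.log (pz (Z ω))) ≤ 0 := by
    calc _ ≤ ∑ ω, μ ω * (F (X ω, Y ω, Z ω) - 1) := by
          refine Finset.sum_le_sum fun ω _ => ?_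
          rcases (hμ.1 ω).eq_or_lt with h0 | h0
          · simp [← h0]
          · refine mul_le_mul_of_nonneg_left ?_ h0.le
            have p1 : 0 < pxyz (X ω, Y ω, Z ω) :=
              h0.trans_le (le_rvDist hμ (fun ω => (X ω, Y ω, Z ω)) ω)
            have p2 : 0 < pxz (X ω, Z ω) := h0.trans_le (le_rvDist hμ (fun ω => (X ω, Z ω)) ω)
            have p3 : 0 < pyz (Y ω, Z ω) := h0.trans_le (le_rvDist hμ (fun ω => (Y ω, Z ω)) ω)
            have p4 : 0 < pz (Z ω) := h0.trans_le (le_rvDist hμ Z ω)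
            have := Real.log_le_sub_one_of_pos
              (show 0 < F (X ω, Y ω, Z ω) from div_pos (mul_pos p2 p3) (mul_pos p1 p4))
            refine le_trans (le_of_eq ?_) this
            simp only [F]
            rw [Real.log_div (mul_pos p2 p3).ne' (mul_pos p1 p4).ne',
              Real.log_mul p2.ne' p3.ne', Real.log_mul p1.ne' p4.ne']
            ring
      _ = ∑ ω, μ ω * F (X ω, Y ω, Z ω) - 1 := by
          simp_rw [mul_sub, mul_one, Finset.sum_sub_distrib, hμ.2]
      _ ≤ 0 := by linarith
  simp only [H_eq_sum]
  simp_rw [mul_sub, mul_add, Finset.sum_sub_distrib, Finset.sum_add_distrib] at key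
  linarith

lemma H_const {α : Type*} [Fintype α] [DecidableEq α] (hμ : IsPMF μ) (X : Ω → α)
    (h : ∀ ω ω', X ω = X ω') : H μ X = 0 := by
  rw [H_eq_sum]
  have : ∀ ω, rvDist μ X (X ω) = 1 := fun ω => by
    rw [← hμ.2]
    exact Finset.sum_congr rfl fun ω' _ => by simp [h ω' ω]
  simp [this]

/-- Conditional subadditivity together with the fact that conditioning reduces entropy. -/
lemma H_condsub {ι α β γ : Type*} [Fintype ι] [DecidableEq ι] [Fintype α] [DecidableEq α]
    [Fintype β] [DecidableEq β] [Fintype γ] [DecidableEq γ] (hμ : IsPMF μ)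
    (A : ι → Ω → α) (B : Ω → β) (C : ι → Ω → γ)
    (hBC : ∀ i ω ω', B ω = B ω' → C i ω = C i ω') :
    H μ (fun ω => ((fun i => A i ω), B ω)) - H μ B ≤
      ∑ i, (H μ (fun ω => (A i ω, C i ω)) - H μ (C i)) := by
  have key : ∀ s : Finset ι,
      H μ (fun ω => ((fun i => if i ∈ s then some (A i ω) else none), B ω)) - H μ B ≤
        ∑ i ∈ s, (H μ (fun ω => (A i ω, C i ω)) - H μ (C i)) := by
    intro s
    induction s using Finset.induction_on with
    | empty =>
      rw [H_congr (fun ω => ((fun i => if i ∈ (∅ : Finset ι) then some (A i ω) else none), B ω)) B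
        (by simp)]
      simp
    | insert j s hj ih =>
      rw [Finset.sum_insert hj]
      have h1 := H_submod hμ (A j)
        (fun ω => ((fun i => if i ∈ s then some (A i ω) else none), B ω)) (C j)
      have e1 : H μ (fun ω => (A j ω,
            ((fun i => if i ∈ s then some (A i ω) else none), B ω), C j ω)) =
          H μ (fun ω => ((fun i => if i ∈ insert j s then some (A i ω) else none), B ω)) := by
        apply H_congr
        intro ω ω'
        simp only [Prod.mk.injEq, funext_iff, Finset.mem_insert]
        constructor
        · rintro ⟨h1, ⟨h2, h3⟩, h4⟩
          refine ⟨fun i => ?_, h3⟩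
          by_cases hi : i = j
          · subst hi; simp [h1]
          · simpa [hi] using h2 i
        · rintro ⟨h1, h2⟩
          refine ⟨by simpa using h1 j, ⟨fun i => ?_, h2⟩, hBC j _ _ h2⟩
          by_cases hi : i = j
          · subst hi; simp [hj]
          · simpa [hi] using h1 i
      have e2 : H μ (fun ω => (((fun i => if i ∈ s then some (A i ω) else none), B ω), C j ω)) =
          H μ (fun ω => ((fun i => if i ∈ s then some (A i ω) else none), B ω)) := by
        apply H_congr
        intro ω ω'
        simp only [Prod.mk.injEq]
        exact ⟨fun h => h.1, fun h => ⟨h, hBC j _ _ h.2⟩⟩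
      rw [e1, e2] at h1
      linarith
  have := key Finset.univ
  rw [H_congr _ (fun ω => ((fun i => A i ω), B ω)) (by simp [funext_iff])] at this
  exact this

lemma H_sub {ι α : Type*} [Fintype ι] [DecidableEq ι] [Fintype α] [DecidableEq α]
    (hμ : IsPMF μ) (A : ι → Ω → α) :
    H μ (fun ω => (fun i => A i ω)) ≤ ∑ i, H μ (A i) := by
  have := H_condsub hμ A (fun _ => ()) (fun _ _ => ()) (by simp)
  rw [H_const hμ (fun _ => ()) (by simp)] at this
  rw [H_congr _ (fun ω => (fun i => A i ω)) (by simp)] at this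
  simp only [sub_zero] at this
  refine this.trans (Finset.sum_le_sum fun i _ => ?_)
  rw [H_congr _ (A i) (by simp)]

lemma H_pair_le {α β : Type*} [Fintype α] [DecidableEq α] [Fintype β] [DecidableEq β]
    (hμ : IsPMF μ) (X : Ω → α) (Y : Ω → β) :
    H μ (fun ω => (X ω, Y ω)) ≤ H μ X + H μ Y := by
  have := H_submod hμ X Y (fun _ => ())
  rw [H_const hμ (fun _ => ()) (by simp)] at this
  rw [H_congr (fun ω => (X ω, Y ω, ())) (fun ω => (X ω, Y ω)) (by simp),
    H_congr (fun ω => (X ω, ())) X (by simp), H_congr (fun ω => (Y ω, ())) Y (by simp)] at this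
  linarith

/-! ### continuity of entropy -/

lemma log_le_neg_one {y : ℝ} (h0 : 0 < y) (h : y ≤ 1 / 4) : Real.log y ≤ -1 := by
  have h1 : Real.log y ≤ Real.log (1 / 4) := Real.log_le_log h0 h
  have h2 : Real.log (1 / 4 : ℝ) = -(2 * Real.log 2) := by
    rw [show (1 / 4 : ℝ) = (2 ^ 2)⁻¹ by norm_num, Real.log_inv, Real.log_pow]; simp
  have := Real.log_two_gt_d9
  linarith

lemma negMulLog_tangent {x y : ℝ} (hx : 0 ≤ x) (hy : 0 < y) :
    Real.negMulLog x - Real.negMulLog y ≤ (y - x) * (Real.log y + 1) := by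
  unfold Real.negMulLog
  rcases hx.eq_or_lt with h0 | h0
  · subst h0; simp; linarith
  · have h := Real.log_le_sub_one_of_pos (div_pos hy h0)
    rw [Real.log_div hy.ne' h0.ne'] at h
    have h' := mul_le_mul_of_nonneg_left h hx
    have : x * (y / x - 1) = y - x := by field_simp
    rw [this] at h'
    linarith

lemma negMulLog_mono {x y : ℝ} (hx : 0 ≤ x) (hxy : x ≤ y) (hy : y ≤ 1 / 4) :
    Real.negMulLog x ≤ Real.negMulLog y := by
  rcases hx.eq_or_lt with h0 | h0
  · subst h0
    rw [Real.negMulLog_zero]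
    exact Real.negMulLog_nonneg hxy (by linarith)
  have h := negMulLog_tangent hx (h0.trans_le hxy)
  have := log_le_neg_one (h0.trans_le hxy) hy
  nlinarith

lemma negMulLog_diff {x y : ℝ} (hx : 0 ≤ x) (hy : 0 ≤ y) (hy1 : y ≤ 1)
    (hd : |x - y| ≤ 1 / 4) :
    Real.negMulLog x - Real.negMulLog y ≤ Real.negMulLog |x - y| := by
  rcases lt_trichotomy x y with h | h | h
  · have hy0 : 0 < y := hx.trans_lt h
    have h1 := negMulLog_tangent hx hy0
    have h2 := Real.log_nonpos hy hy1
    rw [abs_of_neg (by linarith)] at hd ⊢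
    have h3 := log_le_neg_one (y := -(x - y)) (by linarith) hd
    have : -(x - y) ≤ Real.negMulLog (-(x - y)) := by
      unfold Real.negMulLog
      nlinarith
    nlinarith
  · subst h; simp
  · rw [abs_of_pos (by linarith)]
    have h4 : Real.negMulLog x = - ((x - y) * Real.log x) - y * Real.log x := by
      unfold Real.negMulLog; ring
    rw [h4]
    unfold Real.negMulLog
    have h5 : Real.log (x - y) ≤ Real.log x := Real.log_le_log (by linarith) (by linarith)
    have h6 : y * Real.log y ≤ y * Real.log x := by
      rcases hy.eq_or_lt with h0 | h0
      · simp [← h0]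
      · exact mul_le_mul_of_nonneg_left (Real.log_le_log h0 h.le) hy
    have h7 := mul_le_mul_of_nonneg_left h5 (show 0 ≤ x - y by linarith)
    linarith

lemma sum_negMulLog_le {α : Type*} [Fintype α] [Nonempty α] (d : α → ℝ) (hd : ∀ a, 0 ≤ d a) :
    ∑ a, Real.negMulLog (d a) ≤
      (∑ a, d a) * Real.log (Fintype.card α) + Real.negMulLog (∑ a, d a) := by
  set N : ℝ := (Fintype.card α : ℝ) with hN
  have hN0 : 0 < N := by simp [hN, Fintype.card_pos]
  have := Real.concaveOn_negMulLog.le_map_sum (t := Finset.univ) (w := fun _ : α => N⁻¹)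
    (p := d) (fun _ _ => by positivity) (by simp [← hN, hN0.ne']) (fun a _ => hd a)
  simp only [smul_eq_mul, ← Finset.mul_sum] at this
  set s := ∑ a, d a with hs
  have h2 : Real.negMulLog (N⁻¹ * s) = N⁻¹ * (s * Real.log N + Real.negMulLog s) := by
    by_cases h0 : s = 0
    · simp [h0]
    · unfold Real.negMulLog
      rw [Real.log_mul (inv_ne_zero hN0.ne') h0, Real.log_inv]; ring
  rw [h2] at this
  exact le_of_mul_le_mul_left this (by positivity)

lemma IsPMF.le_one {α : Type*} [Fintype α] {p : α → ℝ} (h : IsPMF p) (a : α) : p a ≤ 1 := by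
  rw [← h.2]
  exact Finset.single_le_sum (fun i _ => h.1 i) (Finset.mem_univ a)

lemma IsPMF.nonempty {α : Type*} [Fintype α] {p : α → ℝ} (h : IsPMF p) : Nonempty α := by
  by_contra hne
  rw [not_nonempty_iff] at hne
  have := h.2
  simp at this

lemma ent_le {α : Type*} [Fintype α] {p : α → ℝ} (h : IsPMF p) :
    ent p ≤ Real.log (Fintype.card α) := by
  have := h.nonempty
  have := sum_negMulLog_le p h.1
  simpa [h.2, ent] using this

lemma ent_nonneg {α : Type*} [Fintype α] {p : α → ℝ} (h : IsPMF p) : 0 ≤ ent p :=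
  Finset.sum_nonneg fun a _ => Real.negMulLog_nonneg (h.1 a) (h.le_one a)

lemma ent_diff {α : Type*} [Fintype α] {p q : α → ℝ} (hp : IsPMF p) (hq : IsPMF q) {ε : ℝ}
    (hε : ε ≤ 1 / 4) (h : ∑ a, |p a - q a| ≤ ε) :
    ent p - ent q ≤ ε * Real.log (Fintype.card α) + Real.negMulLog ε := by
  have := hp.nonempty
  have h1 : ent p - ent q ≤ ∑ a, Real.negMulLog |p a - q a| := by
    unfold ent
    rw [← Finset.sum_sub_distrib]
    refine Finset.sum_le_sum fun a _ => negMulLog_diff (hp.1 a) (hq.1 a) (hq.le_one a) ?_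
    have := Finset.single_le_sum (f := fun a => |p a - q a|) (fun i _ => abs_nonneg _)
      (Finset.mem_univ a)
    linarith
  have h2 := sum_negMulLog_le (fun a => |p a - q a|) (fun a => abs_nonneg _)
  have h3 := negMulLog_mono (Finset.sum_nonneg fun a _ => abs_nonneg (p a - q a)) h hε
  have h4 : 0 ≤ Real.log (Fintype.card α) :=
    Real.log_nonneg (by exact_mod_cast Fintype.card_pos)
  have h5 := mul_le_mul_of_nonneg_right h h4
  linarith

lemma tv_map {α β : Type*} [Fintype α] [Fintype β] [DecidableEq β] (p q : α → ℝ) (g : α → β) :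
    ∑ b, |rvDist p g b - rvDist q g b| ≤ ∑ a, |p a - q a| := by
  calc _ ≤ ∑ b, rvDist (fun a => |p a - q a|) g b := by
        refine Finset.sum_le_sum fun b _ => ?_
        unfold rvDist
        rw [← Finset.sum_sub_distrib]
        refine (Finset.abs_sum_le_sum_abs _ _).trans (Finset.sum_le_sum fun a _ => ?_)
        split_ifs <;> simp
    _ = _ := by
        have := sum_rvDist_mul (fun a => |p a - q a|) g (fun _ => 1)
        simpa using this

lemma rvDist_comp {α β : Type*} [Fintype α] [DecidableEq α] [DecidableEq β] (X : Ω → α)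
    (g : α → β) : rvDist (rvDist μ X) g = rvDist μ (fun ω => g (X ω)) := by
  funext b
  have := sum_rvDist_mul μ X (fun a => if g a = b then 1 else 0)
  simpa [rvDist] using this

/-! ### product distributions -/

lemma prod_marg {ι α : Type*} [Fintype ι] [DecidableEq ι] [Fintype α] {q : α → ℝ}
    (hq : IsPMF q) (i : ι) (F : α → ℝ) :
    ∑ f : ι → α, (∏ j, q (f j)) * F (f i) = ∑ a, q a * F a := by
  have h := Fintype.prod_sum (fun (j : ι) (a : α) => q a * (if j = i then F a else 1))
  have h1 : ∀ j : ι, ∑ a, q a * (if j = i then F a else 1) =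
      if j = i then ∑ a, q a * F a else 1 := by
    intro j
    by_cases hj : j = i <;> simp [hj, hq.2]
  simp_rw [h1] at h
  rw [Finset.prod_ite_eq' Finset.univ i] at h
  simp only [Finset.mem_univ, if_true] at h
  rw [h]
  refine Finset.sum_congr rfl fun f _ => ?_
  rw [Finset.prod_mul_distrib, Finset.prod_ite_eq' Finset.univ i]
  simp

lemma prod_isPMF {ι α : Type*} [Fintype ι] [DecidableEq ι] [Fintype α] {q : α → ℝ}
    (hq : IsPMF q) : IsPMF (fun f : ι → α => ∏ j, q (f j)) := by
  refine ⟨fun f => Finset.prod_nonneg fun j _ => hq.1 _, ?_⟩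
  rw [← Fintype.prod_sum (fun (_ : ι) (a : α) => q a)]
  simp [hq.2]

lemma prod_rvDist {ι α : Type*} [Fintype ι] [DecidableEq ι] [Fintype α] [DecidableEq α]
    {q : α → ℝ} (hq : IsPMF q) (i : ι) :
    rvDist (fun f : ι → α => ∏ j, q (f j)) (fun f => f i) = q := by
  funext a
  have := prod_marg hq i (fun b => if b = a then 1 else 0)
  simpa [rvDist] using this

lemma prod_ent {ι α : Type*} [Fintype ι] [DecidableEq ι] [Fintype α]
    {q : α → ℝ} (hq : IsPMF q) :
    ent (fun f : ι → α => ∏ j, q (f j)) = Fintype.card ι * ent q := by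
  have h1 : ∀ f : ι → α, Real.negMulLog (∏ j, q (f j)) =
      ∑ i, (∏ j, q (f j)) * (- Real.log (q (f i))) := by
    intro f
    by_cases h : ∏ j, q (f j) = 0
    · simp [h]
    · rw [Real.negMulLog, Real.log_prod (fun j _ => (Finset.prod_ne_zero_iff.1 h) j
        (Finset.mem_univ j)), ← Finset.mul_sum, Finset.sum_neg_distrib]
      ring
  unfold ent
  simp_rw [h1]
  rw [Finset.sum_comm]
  simp_rw [prod_marg hq _ (fun a => - Real.log (q a))]
  simp [Real.negMulLog]

/-- The near-i.i.d. entropy gap bound. -/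
lemma gap_bound {A : Type*} [Fintype A] [DecidableEq A] (n : ℕ) (hn : 0 < n)
    (P : (Fin n → A) → ℝ) (hP : IsPMF P) (q : A → ℝ) (hq : IsPMF q)
    (ε : ℝ) (hε0 : 0 < ε) (hε1 : ε ≤ 1) (h : ∑ f, |P f - ∏ i, q (f i)| ≤ ε) :
    ∑ i, ent (rvDist P (fun f => f i)) - ent P ≤
      n * (2 * Real.sqrt ε * (ent q + Real.log (Fintype.card A) + Real.log (1 / Real.sqrt ε))) := by
  have := hq.nonempty
  have hs0 : 0 < Real.sqrt ε := Real.sqrt_pos.2 hε0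
  have hs1 : Real.sqrt ε ≤ 1 := Real.sqrt_le_one.2 hε1
  have hss : Real.sqrt ε * Real.sqrt ε = ε := Real.mul_self_sqrt hε0.le
  have hLA : 0 ≤ Real.log (Fintype.card A) :=
    Real.log_nonneg (by exact_mod_cast Fintype.card_pos)
  have hL : 0 ≤ Real.log (1 / Real.sqrt ε) :=
    Real.log_nonneg (by rw [le_div_iff₀ hs0]; linarith)
  have hEq := ent_nonneg hq
  have hn1 : (1 : ℝ) ≤ n := by exact_mod_cast hn
  set s := Real.sqrt ε with hs
  set LA := Real.log (Fintype.card A) with hLAd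
  set L := Real.log (1 / s) with hLd
  by_cases hc : s ≤ 1 / 2
  · have hε4 : ε ≤ 1 / 4 := by nlinarith
    have hφ : Real.negMulLog ε = 2 * ε * L := by
      rw [hLd, one_div, Real.log_inv, Real.negMulLog]
      have : Real.log ε = 2 * Real.log s := by
        rw [← hss, Real.log_mul hs0.ne' hs0.ne']; ring
      rw [this]; ring
    have h1 : ∀ i : Fin n, ent (rvDist P (fun f => f i)) - ent q ≤ ε * LA + 2 * ε * L := by
      intro i
      have t := tv_map P (fun f : Fin n → A => ∏ i, q (f i)) (fun f => f i)
      rw [prod_rvDist hq i] at t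
      rw [← hφ]
      exact ent_diff (rvDist_isPMF hP _) hq hε4 (t.trans h)
    have h2 : n * ent q - ent P ≤ ε * (n * LA) + 2 * ε * L := by
      have := ent_diff (prod_isPMF (ι := Fin n) hq) hP hε4
        (by simpa only [abs_sub_comm] using h)
      rw [prod_ent hq, hφ] at this
      simpa [Fintype.card_fun, Real.log_pow] using this
    have h3 : ∑ i : Fin n, ent (rvDist P (fun f => f i)) ≤
        n * (ent q + (ε * LA + 2 * ε * L)) := by
      calc _ ≤ ∑ i : Fin n, (ent q + (ε * LA + 2 * ε * L)) :=
            Finset.sum_le_sum fun i _ => by linarith [h1 i]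
        _ = _ := by simp; ring
    have h4 : ε * LA ≤ s * LA := mul_le_mul_of_nonneg_right (by nlinarith) hLA
    have h5 : 2 * ε * L ≤ s * L := mul_le_mul_of_nonneg_right (by nlinarith) hL
    have h6 : 0 ≤ s * ent q := mul_nonneg hs0.le hEq
    have h7 : s * L ≤ n * (s * L) := le_mul_of_one_le_left (mul_nonneg hs0.le hL) hn1
    have h8 : (n : ℝ) * (ε * LA) ≤ n * (s * LA) := mul_le_mul_of_nonneg_left h4 (by linarith)
    have h9 : (n : ℝ) * (2 * ε * L) ≤ n * (s * L) := mul_le_mul_of_nonneg_left h5 (by linarith)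
    have h10 : 0 ≤ (n : ℝ) * (s * ent q) := mul_nonneg (by linarith) h6
    linarith
  · have h1 : ∑ i : Fin n, ent (rvDist P (fun f => f i)) ≤ n * LA := by
      calc _ ≤ ∑ i : Fin n, LA := Finset.sum_le_sum fun i _ => ent_le (rvDist_isPMF hP _)
        _ = _ := by simp
    have h2 := ent_nonneg hP
    have h3 : LA ≤ 2 * s * (ent q + LA + L) := by
      have : (1 : ℝ) ≤ 2 * s := by linarith
      nlinarith
    have h4 : (n : ℝ) * LA ≤ _ := mul_le_mul_of_nonneg_left h3 (by linarith)
    linarith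

end helpers

/-- Single-letter lower bound on the shared randomness rate `R₀₁` in the converse of
Theorem 2: `nR₀₁ ≥ Σᵢ I(K₁, Ỹ₁_{∼i}, W_{∼i}, Ỹ₁ᵢ; X₁ᵢ, Yᵢ | X₂ᵢ, Wᵢ) − Σᵢ H(Ỹ₁ᵢ|Wᵢ) − n g(ε)`,
where `g(ε) = 2√ε (H_q(X₁,X₂,W,Y) + log(|𝒳₁||𝒳₂||𝒲||𝒴|) + log(1/√ε))`. -/
theorem converse_step_R01_bound
    {Ω 𝒳₁ 𝒳₂ 𝒲 𝒴 ℬ : Type*}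
    [Fintype Ω] [Fintype 𝒳₁] [Fintype 𝒳₂] [Fintype 𝒲] [Fintype 𝒴] [Fintype ℬ]
    [DecidableEq 𝒳₁] [DecidableEq 𝒳₂] [DecidableEq 𝒲] [DecidableEq 𝒴] [DecidableEq ℬ]
    (n : ℕ) (hn : 0 < n) (R01 : ℝ) (k : ℕ)
    -- `K₁` is uniform on an index set of size `2^{nR₀₁}` (assumed an integer)
    (hk : (k : ℝ) = (2 : ℝ) ^ ((n : ℝ) * R01))
    (μ : Ω → ℝ) (hμ : IsPMF μ)
    (X1v : Fin n → Ω → 𝒳₁) (X2v : Fin n → Ω → 𝒳₂) (Wv : Fin n → Ω → 𝒲)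
    (K1 : Ω → Fin k) (Yt1v : Fin n → Ω → ℬ) (Yv : Fin n → Ω → 𝒴)
    (q3 : 𝒳₁ × 𝒳₂ × 𝒲 → ℝ) (hq3 : IsPMF q3)
    -- the triples `(X₁ᵢ, X₂ᵢ, Wᵢ)` are i.i.d. with common pmf `q3`
    (hiid : ∀ f : Fin n → 𝒳₁ × 𝒳₂ × 𝒲,
      rvDist μ (fun ω => fun i => (X1v i ω, X2v i ω, Wv i ω)) f = ∏ i, q3 (f i))
    -- `K₁` is uniform
    (hunif : ∀ a : Fin k, rvDist μ K1 a = (k : ℝ)⁻¹)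
    -- `K₁` is independent of `(X₁ⁿ, X₂ⁿ, Wⁿ)`
    (hindep : ∀ (a : Fin k) (b : Fin n → 𝒳₁ × 𝒳₂ × 𝒲),
      rvDist μ (fun ω => (K1 ω, fun i => (X1v i ω, X2v i ω, Wv i ω))) (a, b) =
        rvDist μ K1 a * rvDist μ (fun ω => fun i => (X1v i ω, X2v i ω, Wv i ω)) b)
    (q4 : 𝒳₁ × 𝒳₂ × 𝒲 × 𝒴 → ℝ) (hq4 : IsPMF q4)
    (hmarg : ∀ x1 x2 w, ∑ y, q4 (x1, x2, w, y) = q3 (x1, x2, w))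
    (ε : ℝ) (hε0 : 0 < ε) (hε1 : ε ≤ 1)
    -- `‖p_{X₁ⁿX₂ⁿWⁿYⁿ} − q⁽ⁿ⁾‖₁ ≤ ε`
    (hTV : ∑ z : (Fin n → 𝒳₁) × (Fin n → 𝒳₂) × (Fin n → 𝒲) × (Fin n → 𝒴),
      |rvDist μ (fun ω =>
          ((fun i => X1v i ω), (fun i => X2v i ω), (fun i => Wv i ω), fun i => Yv i ω)) z
        - ∏ i, q4 (z.1 i, z.2.1 i, z.2.2.1 i, z.2.2.2 i)| ≤ ε) :
    (n : ℝ) * R01 ≥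
      (∑ i : Fin n,
        condI μ
          (fun ω => (K1 ω, fun j : {j : Fin n // j ≠ i} => Yt1v j.1 ω,
            fun j : {j : Fin n // j ≠ i} => Wv j.1 ω, Yt1v i ω))
          (fun ω => (X1v i ω, Yv i ω)) (fun ω => (X2v i ω, Wv i ω)))
      - (∑ i : Fin n, condH μ (Yt1v i) (Wv i))
      - (n : ℝ) *
          (2 * Real.sqrt ε *
            (ent q4 +
              Real.log ((Fintype.card 𝒳₁ : ℝ) * Fintype.card 𝒳₂ * Fintype.card 𝒲 *
                Fintype.card 𝒴) +
              Real.log (1 / Real.sqrt ε))) := by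
  classical
  -- `log k ≤ n R₀₁`
  have hk1 : 1 ≤ k := by
    rcases Nat.eq_zero_or_pos k with h | h
    · subst h
      have : (0 : ℝ) < (2 : ℝ) ^ ((n : ℝ) * R01) := by positivity
      rw [← hk] at this
      simp at this
    · exact h
  have hlogk : Real.log k = n * R01 * Real.log 2 := by
    rw [hk, Real.log_rpow (by norm_num)]
  have hlogk0 : 0 ≤ Real.log k := Real.log_nonneg (by exact_mod_cast hk1)
  have hl2 := Real.log_two_gt_d9
  have hl2' := Real.log_two_lt_d9
  have hnR : 0 ≤ (n : ℝ) * R01 := by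
    rw [hlogk] at hlogk0
    exact nonneg_of_mul_nonneg_left hlogk0 (by linarith)
  have hkR : Real.log k ≤ n * R01 := by
    rw [hlogk]; nlinarith
  have hHK : H μ K1 ≤ Real.log k := by
    simpa [H] using ent_le (rvDist_isPMF hμ K1)
  -- the joint process
  let Zv : Ω → Fin n → 𝒳₁ × 𝒳₂ × 𝒲 × 𝒴 := fun ω i => (X1v i ω, X2v i ω, Wv i ω, Yv i ω)
  let e : (Fin n → 𝒳₁ × 𝒳₂ × 𝒲 × 𝒴) ≃
      (Fin n → 𝒳₁) × (Fin n → 𝒳₂) × (Fin n → 𝒲) × (Fin n → 𝒴) :=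
    { toFun := fun f => (fun i => (f i).1, fun i => (f i).2.1, fun i => (f i).2.2.1,
        fun i => (f i).2.2.2)
      invFun := fun z i => (z.1 i, z.2.1 i, z.2.2.1 i, z.2.2.2 i)
      left_inv := fun f => rfl
      right_inv := fun z => rfl }
  have hTV' : ∑ f, |rvDist μ Zv f - ∏ i, q4 (f i)| ≤ ε := by
    rw [← e.sum_comp] at hTV
    refine le_trans (le_of_eq (Finset.sum_congr rfl fun f _ => ?_)) hTV
    have : rvDist μ (fun ω =>
        ((fun i => X1v i ω), (fun i => X2v i ω), (fun i => Wv i ω), fun i => Yv i ω)) (e f)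
        = rvDist μ Zv f := by
      unfold rvDist
      refine Finset.sum_congr rfl fun ω _ => ?_
      have : ((fun i => X1v i ω), (fun i => X2v i ω), (fun i => Wv i ω), fun i => Yv i ω)
          = e (Zv ω) := rfl
      simp only [this, e.apply_eq_iff_eq]
    rw [this]
    rfl
  have hgap := gap_bound n hn (rvDist μ Zv) (rvDist_isPMF hμ Zv) q4 hq4 ε hε0 hε1 hTV'
  simp only [rvDist_comp] at hgap
  have hcard : Real.log (Fintype.card (𝒳₁ × 𝒳₂ × 𝒲 × 𝒴) : ℝ) =
      Real.log ((Fintype.card 𝒳₁ : ℝ) * Fintype.card 𝒳₂ * Fintype.card 𝒲 * Fintype.card 𝒴) := by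
    simp [Fintype.card_prod, mul_assoc]
  rw [hcard] at hgap
  -- entropy inequalities
  let B : Ω → (Fin n → 𝒳₂) × Fin k × (Fin n → ℬ) × (Fin n → 𝒲) := fun ω =>
    (fun i => X2v i ω, K1 ω, fun i => Yt1v i ω, fun i => Wv i ω)
  let C : Fin n → Ω → 𝒳₂ × Fin k × (Fin n → ℬ) × (Fin n → 𝒲) := fun i ω =>
    (X2v i ω, K1 ω, fun i => Yt1v i ω, fun i => Wv i ω)
  let D : Ω → (Fin n → 𝒳₂ × 𝒲) := fun ω i => (X2v i ω, Wv i ω)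
  have s1 := H_condsub hμ (fun i ω => (X1v i ω, Yv i ω)) B C (by
    intro i ω ω' h
    simp only [B, C, Prod.mk.injEq, funext_iff] at h ⊢
    exact ⟨h.1 i, h.2⟩)
  have s2 := H_condsub hμ Yt1v D Wv (by
    intro i ω ω' h
    simp only [D, funext_iff, Prod.mk.injEq] at h
    exact (h i).2)
  have s3 : H μ D ≤ _ := H_sub hμ (fun i ω => (X2v i ω, Wv i ω))
  have s4 : H μ B ≤ H μ K1 + H μ (fun ω => ((fun i => Yt1v i ω), D ω)) := by
    refine le_trans (H_mono hμ _ _ ?_) (H_pair_le hμ K1 (fun ω => ((fun i => Yt1v i ω), D ω)))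
    intro ω ω' h
    simp only [B, D, Prod.mk.injEq, funext_iff] at h ⊢
    exact ⟨fun i => (h.2.2 i).1, h.1, h.2.1, fun i => (h.2.2 i).2⟩
  have s5 : H μ Zv ≤ H μ (fun ω => ((fun i => (X1v i ω, Yv i ω)), B ω)) := by
    refine H_mono hμ _ _ ?_
    intro ω ω' h
    simp only [B, Zv, Prod.mk.injEq, funext_iff] at h ⊢
    exact fun i => ⟨(h.1 i).1, h.2.1 i, h.2.2.2.2 i, (h.1 i).2⟩
  have s6 : ∀ i : Fin n, condI μ
          (fun ω => (K1 ω, fun j : {j : Fin n // j ≠ i} => Yt1v j.1 ω,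
            fun j : {j : Fin n // j ≠ i} => Wv j.1 ω, Yt1v i ω))
          (fun ω => (X1v i ω, Yv i ω)) (fun ω => (X2v i ω, Wv i ω)) =
        ent (rvDist μ (fun ω => Zv ω i)) - H μ (fun ω => (X2v i ω, Wv i ω))
        - (H μ (fun ω => ((X1v i ω, Yv i ω), C i ω)) - H μ (C i)) := by
    intro i
    have aux : ∀ {T : Type _} (f : Fin n → Ω → T) (ω ω' : Ω),
        (∀ j, f j ω = f j ω') ↔ ((∀ j : {j : Fin n // j ≠ i}, f j.1 ω = f j.1 ω') ∧
          f i ω = f i ω') := by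
      intro T f ω ω'
      refine ⟨fun h => ⟨fun j => h _, h _⟩, fun h j => ?_⟩
      by_cases hj : j = i
      · rw [hj]; exact h.2
      · exact h.1 ⟨j, hj⟩
    have auxY := aux Yt1v
    have auxW := fun ω ω' : Ω => (show (∀ j, Wv j ω = Wv j ω') ↔
        ((∀ j : {j : Fin n // j ≠ i}, Wv j.1 ω = Wv j.1 ω') ∧ Wv i ω = Wv i ω') from by
      refine ⟨fun h => ⟨fun j => h _, h _⟩, fun h j => ?_⟩
      by_cases hj : j = i
      · rw [hj]; exact h.2
      · exact h.1 ⟨j, hj⟩)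
    unfold condI
    have e1 : H μ (fun ω => ((K1 ω, (fun j : {j : Fin n // j ≠ i} => Yt1v j.1 ω),
            (fun j : {j : Fin n // j ≠ i} => Wv j.1 ω), Yt1v i ω), (X2v i ω, Wv i ω)))
          = H μ (C i) := by
      apply H_congr
      intro ω ω'
      simp only [C, Prod.mk.injEq, funext_iff, auxY ω ω', auxW ω ω']
      tauto
    have e2 : H μ (fun ω => ((K1 ω, (fun j : {j : Fin n // j ≠ i} => Yt1v j.1 ω),
            (fun j : {j : Fin n // j ≠ i} => Wv j.1 ω), Yt1v i ω),
            (X1v i ω, Yv i ω), (X2v i ω, Wv i ω)))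
          = H μ (fun ω => ((X1v i ω, Yv i ω), C i ω)) := by
      apply H_congr
      intro ω ω'
      simp only [C, Prod.mk.injEq, funext_iff, auxY ω ω', auxW ω ω']
      tauto
    have e3 : H μ (fun ω => ((X1v i ω, Yv i ω), (X2v i ω, Wv i ω)))
          = ent (rvDist μ (fun ω => Zv ω i)) := by
      change _ = H μ (fun ω => Zv ω i)
      apply H_congr
      intro ω ω'
      simp only [Zv, Prod.mk.injEq]
      tauto
    rw [e1, e2, e3]
    ring
  simp_rw [s6]
  have s7 : ent (rvDist μ Zv) = H μ Zv := rfl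
  rw [s7] at hgap
  unfold condH
  rw [Finset.sum_sub_distrib, Finset.sum_sub_distrib]
  have s8 : H μ K1 ≤ n * R01 := hHK.trans hkR
  linarith
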